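/- Let ξ ∈ (0,1), b ∈ (0,1), and μ ∈ [ξ, b·(1-ξ) + ξ]. For m ∈ ℝ define λ(m) := min(b/ξ, max((m - ξ)/(ξ·(1-ξ)), 0)). Let P be a probability measure on ℝ with P([0,1]) = 1 and mean ∫ x dP(x) = μ. Then for every m ∈ ℝ, ∫ log(1 + λ(m)·(x - ξ)) dP(x) ≥ d(μ, ξ) - |m - μ| / ((1-b)·ξ·(1-ξ)), where d(μ, ξ) := μ·log(μ/ξ) + (1 - μ)·log((1 - μ)/(1 - ξ)). -/

import Mathlib

open MeasureTheory

/-- On `[0,1]`, the concave function `x ↦ log (1 + l * (x - ξ))` lies above its chord. -/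
lemma chord_le_log_one_add_mul_sub {ξ l x : ℝ} (h0 : 0 < 1 - l * ξ)
    (h1 : 0 < 1 + l * (1 - ξ)) (hx : x ∈ Set.Icc (0 : ℝ) 1) :
    x * Real.log (1 + l * (1 - ξ)) + (1 - x) * Real.log (1 - l * ξ)
      ≤ Real.log (1 + l * (x - ξ)) := by
  have h := strictConcaveOn_log_Ioi.concaveOn.2 (Set.mem_Ioi.2 h1) (Set.mem_Ioi.2 h0)
    hx.1 (sub_nonneg.2 hx.2) (by ring)
  simp only [smul_eq_mul] at h
  have e : 1 + l * (x - ξ) = x * (1 + l * (1 - ξ)) + (1 - x) * (1 - l * ξ) := by ring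
  rwa [e]

/-- Among distributions on `[0,1]` with a given mean, the expected log-growth of a bet is
smallest for the Bernoulli distribution. -/
lemma bernoulli_growth_le_integral_log {ξ l : ℝ} (hl : 0 ≤ l)
    (h0 : 0 < 1 - l * ξ) (P : Measure ℝ) [IsProbabilityMeasure P]
    (hP : ∀ᵐ x ∂P, x ∈ Set.Icc (0 : ℝ) 1) :
    (∫ x, x ∂P) * Real.log (1 + l * (1 - ξ)) + (1 - ∫ x, x ∂P) * Real.log (1 - l * ξ)
      ≤ ∫ x, Real.log (1 + l * (x - ξ)) ∂P := by
  have h1 : 0 < 1 + l * (1 - ξ) := by linarith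
  have hid : Integrable (fun x : ℝ => x) P :=
    Integrable.of_mem_Icc 0 1 aemeasurable_id hP
  have hlog : Integrable (fun x : ℝ => Real.log (1 + l * (x - ξ))) P := by
    refine Integrable.of_mem_Icc (Real.log (1 - l * ξ)) (Real.log (1 + l * (1 - ξ)))
      (by fun_prop) ?_
    filter_upwards [hP] with x hx
    have hlo : 1 - l * ξ ≤ 1 + l * (x - ξ) := by nlinarith [hx.1]
    have hhi : 1 + l * (x - ξ) ≤ 1 + l * (1 - ξ) := by nlinarith [hx.2]
    exact ⟨Real.log_le_log h0 hlo, Real.log_le_log (h0.trans_le hlo) hhi⟩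
  have hone : Integrable (fun x : ℝ => 1 - x) P := (integrable_const 1).sub hid
  calc _ = ∫ x, (x * Real.log (1 + l * (1 - ξ)) + (1 - x) * Real.log (1 - l * ξ)) ∂P := by
        rw [integral_add (hid.mul_const _) (hone.mul_const _), integral_mul_const,
          integral_mul_const, integral_sub (integrable_const 1) hid]
        simp
    _ ≤ _ := by
        refine integral_mono_ae ((hid.mul_const _).add (hone.mul_const _)) hlog ?_
        filter_upwards [hP] with x hx
        exact chord_le_log_one_add_mul_sub h0 h1 hx

lemma log_sub_log_le_div {x y : ℝ} (hx : 0 < x) (hy : 0 < y) :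
    Real.log x - Real.log y ≤ (x - y) / y := by
  rw [← Real.log_div hx.ne' hy.ne', sub_div, div_self hy.ne']
  exact Real.log_le_sub_one_of_pos (div_pos hx hy)

/-- The Bernoulli log-growth is Lipschitz in the betting fraction, with constant `1 / (1 - b)`
for fractions in `[0, b / ξ]`. -/
lemma bernoulli_growth_sub_le {ξ b μ l k : ℝ} (hξ : ξ ∈ Set.Ioo (0 : ℝ) 1)
    (hb : b ∈ Set.Ioo (0 : ℝ) 1) (hμ : μ ∈ Set.Icc (0 : ℝ) 1) (hl : 0 ≤ l) (hlb : l * ξ ≤ b)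
    (hk0 : 0 < 1 - k * ξ) (hk1 : 0 < 1 + k * (1 - ξ)) :
    (μ * Real.log (1 + k * (1 - ξ)) + (1 - μ) * Real.log (1 - k * ξ))
      - (μ * Real.log (1 + l * (1 - ξ)) + (1 - μ) * Real.log (1 - l * ξ))
      ≤ |k - l| / (1 - b) := by
  obtain ⟨hξ0, hξ1⟩ := hξ
  obtain ⟨hb0, hb1⟩ := hb
  obtain ⟨hμ0, hμ1⟩ := hμ
  have hl0 : 0 < 1 - l * ξ := by linarith
  have hl1 : 1 ≤ 1 + l * (1 - ξ) := by nlinarith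
  have hb' : 0 < 1 - b := by linarith
  set A := μ * (1 - ξ) / (1 + l * (1 - ξ)) with hA
  set B := (1 - μ) * ξ / (1 - l * ξ) with hB
  have hA0 : 0 ≤ A := div_nonneg (mul_nonneg hμ0 (by linarith)) (by linarith)
  have hB0 : 0 ≤ B := div_nonneg (mul_nonneg (by linarith) hξ0.le) hl0.le
  have hA1 : A ≤ 1 / (1 - b) :=
    div_le_div₀ zero_le_one (by nlinarith) hb' (by linarith)
  have hB1 : B ≤ 1 / (1 - b) :=
    div_le_div₀ zero_le_one (by nlinarith) hb' (by linarith)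
  have e1 := mul_le_mul_of_nonneg_left
    (log_sub_log_le_div hk1 (zero_lt_one.trans_le hl1)) hμ0
  have e2 := mul_le_mul_of_nonneg_left (log_sub_log_le_div hk0 hl0) (sub_nonneg.2 hμ1)
  calc _ ≤ (k - l) * (A - B) := by
        have e : (k - l) * (A - B) = μ * ((1 + k * (1 - ξ) - (1 + l * (1 - ξ)))
            / (1 + l * (1 - ξ))) + (1 - μ) * ((1 - k * ξ - (1 - l * ξ)) / (1 - l * ξ)) := by
          rw [hA, hB]; ring
        linarith
    _ ≤ |k - l| * |A - B| := (le_abs_self _).trans (abs_mul _ _).le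
    _ ≤ |k - l| * (1 / (1 - b)) :=
        mul_le_mul_of_nonneg_left (abs_le.2 ⟨by linarith, by linarith⟩) (abs_nonneg _)
    _ = _ := by ring

/-- Per-observation core of Theorem 2: with the truncated plug-in betting fraction
`λ(m) = min(b/ξ, max((m-ξ)/(ξ(1-ξ)), 0))` computed from an estimate `m` of the mean, the
expected log-growth under any distribution on `[0,1]` with mean `μ ∈ [ξ, b(1-ξ)+ξ]` falls
short of `d(μ,ξ)` by at most `|m - μ| / ((1-b)ξ(1-ξ))`. -/
theorem stmt_13 (ξ b μ : ℝ) (hξ : ξ ∈ Set.Ioo (0:ℝ) 1) (hb : b ∈ Set.Ioo (0:ℝ) 1)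
    (hμ : μ ∈ Set.Icc ξ (b * (1 - ξ) + ξ))
    (P : Measure ℝ) [IsProbabilityMeasure P] (hsupp : P (Set.Icc (0:ℝ) 1) = 1)
    (hmean : (∫ x, x ∂P) = μ) (m : ℝ) :
    (∫ x, Real.log (1 + (min (b/ξ) (max ((m - ξ) / (ξ * (1 - ξ))) 0)) * (x - ξ)) ∂P)
      ≥ (μ * Real.log (μ / ξ) + (1 - μ) * Real.log ((1 - μ) / (1 - ξ)))
          - |m - μ| / ((1 - b) * ξ * (1 - ξ)) := by
  obtain ⟨hξ0, hξ1⟩ := id hξ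
  obtain ⟨hb0, hb1⟩ := id hb
  obtain ⟨hμ0, hμ1⟩ := id hμ
  have hξ' : 0 < 1 - ξ := by linarith
  have hμlt : μ < 1 := by nlinarith
  have hb' : 0 < 1 - b := by linarith
  have hP : ∀ᵐ x ∂P, x ∈ Set.Icc (0 : ℝ) 1 := (mem_ae_iff_prob_eq_one measurableSet_Icc).2 hsupp
  set l := min (b / ξ) (max ((m - ξ) / (ξ * (1 - ξ))) 0) with hl_def
  have hl : 0 ≤ l := le_min (div_pos hb0 hξ0).le (le_max_right _ _)
  have hlb : l * ξ ≤ b := (le_div_iff₀ hξ0).1 (min_le_left _ _)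
  set k := (μ - ξ) / (ξ * (1 - ξ)) with hk_def
  have hk : 0 ≤ k := div_nonneg (by linarith) (by positivity)
  have hkb : k ≤ b / ξ := by
    rw [hk_def, div_le_div_iff₀ (by positivity) hξ0]
    nlinarith
  have hk1 : 1 + k * (1 - ξ) = μ / ξ := by
    rw [hk_def]; field_simp; ring
  have hk0 : 1 - k * ξ = (1 - μ) / (1 - ξ) := by
    rw [hk_def]; field_simp; ring
  have hkl : |k - l| ≤ |m - μ| / (ξ * (1 - ξ)) := by
    have hclip : k = min (b / ξ) (max k 0) := by rw [max_eq_left hk, min_eq_right hkb]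
    calc |k - l| = |min (b / ξ) (max k 0) - l| := by rw [← hclip]
      _ ≤ |max k 0 - max ((m - ξ) / (ξ * (1 - ξ))) 0| := by
          simpa using abs_min_sub_min_le_max (b / ξ) (max k 0) (b / ξ)
            (max ((m - ξ) / (ξ * (1 - ξ))) 0)
      _ ≤ |k - (m - ξ) / (ξ * (1 - ξ))| := abs_max_sub_max_le_abs _ _ _
      _ = |m - μ| / (ξ * (1 - ξ)) := by
          rw [hk_def, ← sub_div, abs_div, abs_of_pos (by positivity : 0 < ξ * (1 - ξ)),
            abs_sub_comm m μ]
          ring_nf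
  have hgrowth := bernoulli_growth_le_integral_log (ξ := ξ) hl (by linarith) P hP
  have hlip := bernoulli_growth_sub_le (k := k) hξ hb ⟨by linarith, hμlt.le⟩ hl hlb
    (hk0 ▸ div_pos (by linarith) hξ') (hk1 ▸ div_pos (by linarith) hξ0)
  rw [hk0, hk1] at hlip
  rw [hmean] at hgrowth
  have herr : |k - l| / (1 - b) ≤ |m - μ| / ((1 - b) * ξ * (1 - ξ)) := by
    calc _ ≤ |m - μ| / (ξ * (1 - ξ)) / (1 - b) := div_le_div_of_nonneg_right hkl hb'.le
      _ = _ := by rw [div_div]; ring_nf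
  linarith
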